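/- Let Δ > 0, let t_k ∈ ℝ, set t_{k+1} = t_k + Δ and t_c = t_k + Δ/2. Let x_k, x_{k+1}, f_k, f_c, f_{k+1} ∈ ℝ, and let p : ℝ → ℝ be a polynomial function of degree at most 3 satisfying p(t_k) = x_k, p(t_{k+1}) = x_{k+1}, p'(t_k) = f_k, and p'(t_{k+1}) = f_{k+1} (the cubic Hermite interpolant on the interval). Then the collocation condition p'(t_c) = f_c holds if and only if the Hermite–Simpson defect equation holds: x_{k+1} − x_k − (Δ/6)·(f_k + 4·f_c + f_{k+1}) = 0. In other words, requiring the derivative of the cubic Hermite interpolant to equal the prescribed midpoint dynamics value f_c is equivalent to enforcing Simpson's integration rule as the dynamic constraint. -/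

import Mathlib

/-- Equivalence of the collocation condition and the Hermite–Simpson defect:
for the cubic Hermite interpolant `p` (degree at most 3, matching node values and node
derivatives on `[t_k, t_k + Δ]`), the collocation condition `p'(t_c) = f_c` at the
midpoint `t_c = t_k + Δ/2` holds if and only if the Simpson's-rule defect
`x_{k+1} − x_k − (Δ/6)(f_k + 4 f_c + f_{k+1}) = 0` holds. -/
theorem hermite_collocation_iff_simpson_defect (Δ tk : ℝ) (hΔ : 0 < Δ)
    (xk xk1 fk fc fk1 : ℝ) (p : Polynomial ℝ) (hdeg : p.degree ≤ 3)
    (hpk : p.eval tk = xk) (hpk1 : p.eval (tk + Δ) = xk1)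
    (hdk : (Polynomial.derivative p).eval tk = fk)
    (hdk1 : (Polynomial.derivative p).eval (tk + Δ) = fk1) :
    (Polynomial.derivative p).eval (tk + Δ / 2) = fc ↔
      xk1 - xk - (Δ / 6) * (fk + 4 * fc + fk1) = 0 := by
  have hn : p.natDegree < 4 :=
    Nat.lt_succ_of_le (Polynomial.natDegree_le_of_degree_le hdeg)
  obtain ⟨a, b, c, d, hp⟩ : ∃ a b c d : ℝ, p = Polynomial.C a + Polynomial.C b * Polynomial.X
      + Polynomial.C c * Polynomial.X ^ 2 + Polynomial.C d * Polynomial.X ^ 3 := by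
    refine ⟨p.coeff 0, p.coeff 1, p.coeff 2, p.coeff 3, ?_⟩
    conv_lhs => rw [p.as_sum_range_C_mul_X_pow' hn]
    simp [Finset.sum_range_succ]
  have key : xk1 - xk = (Δ / 6) *
      (fk + 4 * (Polynomial.derivative p).eval (tk + Δ / 2) + fk1) := by
    rw [← hpk, ← hpk1, ← hdk, ← hdk1, hp]
    simp
    ring
  rw [key]
  constructor
  · intro h
    rw [h]
    ring
  · intro h
    have h2 : Δ * ((Polynomial.derivative p).eval (tk + Δ / 2) - fc) = 0 := by
      linarith
    rcases mul_eq_zero.mp h2 with h3 | h3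
    · exact absurd h3 hΔ.ne'
    · linarith
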